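/- Let ε > 0. There is a constant C(ε) such that for every integer q ≥ 1 and all positive integers a, b, c, a′, b′, c′, writing n = abc and n′ = a′b′c′, one has |Σ′_{h=1}^{q} R_{a,b,c}(h/q) · conj(R_{a′,b′,c′}(h/q))| ≤ C(ε) · q^{3+ε} · gcd(q, n, n′) · Σ_{f | gcd(q, n − n′)} f. -/

import Mathlib

open scoped BigOperators

/-- `e(t) = exp(2πit)` -/
noncomputable def e (t : ℝ) : ℂ := Complex.exp (2 * Real.pi * Complex.I * t)

/-- `R_{a,b,c}(h/q) = Σ_{x,y,z=1}^{q} e((ax + by + cz − hxyz)/q)` -/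
noncomputable def Rabc (a b c h : ℤ) (q : ℕ) : ℂ :=
  ∑ x ∈ Finset.Icc 1 q, ∑ y ∈ Finset.Icc 1 q, ∑ z ∈ Finset.Icc 1 q,
    e (((a * x + b * y + c * z - h * x * y * z : ℤ) : ℝ) / q)

/-- The Kloosterman sum `∑ e((A x + B x⁻¹) / q)` over the units `x` of `ZMod q`. -/
noncomputable def kloostermanSum {q : ℕ} [NeZero q] (A B : ZMod q) : ℂ :=
  ∑ x : (ZMod q)ˣ, ZMod.stdAddChar (A * (x : ZMod q) + B * ((x⁻¹ : (ZMod q)ˣ) : ZMod q))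

/-- The Ramanujan sum `∑ e(t x / q)` over the units `x` of `ZMod q`. -/
noncomputable def ramanujanSum {q : ℕ} [NeZero q] (t : ZMod q) : ℂ :=
  ∑ x : (ZMod q)ˣ, ZMod.stdAddChar (t * (x : ZMod q))

section Counting

lemma natCast_dvd_intCast_zmod_iff {q d : ℕ} (hd : d ∣ q) (m : ℤ) :
    (d : ZMod q) ∣ (m : ZMod q) ↔ (d : ℤ) ∣ m := by
  constructor
  · rintro ⟨k, hk⟩
    obtain ⟨k, rfl⟩ := ZMod.intCast_surjective k
    have h : ((m : ℤ) : ZMod q) = ((d * k : ℤ) : ZMod q) := by push_cast; exact hk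
    rw [ZMod.intCast_eq_intCast_iff_dvd_sub] at h
    have h1 : (d : ℤ) ∣ d * k - m := (Int.natCast_dvd_natCast.2 hd).trans h
    exact (dvd_sub_right (Dvd.intro k rfl)).1 h1
  · rintro ⟨k, rfl⟩
    exact ⟨k, by push_cast; rfl⟩

open scoped Classical in
lemma card_filter_natCast_dvd_le {q d : ℕ} [NeZero q] (hd : d ∣ q) :
    (Finset.univ.filter fun x : ZMod q => (d : ZMod q) ∣ x).card ≤ q / d := by
  obtain ⟨r, rfl⟩ := hd
  have hq : d * r ≠ 0 := NeZero.ne _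
  have hd0 : 0 < d := Nat.pos_of_ne_zero (left_ne_zero_of_mul hq)
  have hr0 : 0 < r := Nat.pos_of_ne_zero (right_ne_zero_of_mul hq)
  rw [Nat.mul_div_cancel_left _ hd0]
  calc _ ≤ ((Finset.range r).image fun j : ℕ => ((d * j : ℕ) : ZMod (d * r))).card := by
        apply Finset.card_le_card
        intro x hx
        obtain ⟨k, rfl⟩ := (Finset.mem_filter.1 hx).2
        refine Finset.mem_image.2 ⟨k.val % r, Finset.mem_range.2 (Nat.mod_lt _ hr0), ?_⟩
        have h1 : ((d * k.val : ℕ) : ZMod (d * r)) = d * k := by simp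
        rw [← h1, ZMod.natCast_eq_natCast_iff]
        exact Nat.ModEq.mul_left' d (Nat.mod_modEq _ _)
    _ ≤ (Finset.range r).card := Finset.card_image_le
    _ = r := Finset.card_range r

/-- A set of residues whose differences are all divisible by `d` has at most `q / d` elements. -/
lemma card_le_of_natCast_dvd_sub {q d : ℕ} [NeZero q] (hd : d ∣ q) (s : Finset (ZMod q))
    (hs : ∀ x ∈ s, ∀ y ∈ s, (d : ZMod q) ∣ x - y) : s.card ≤ q / d := by
  classical
  rcases s.eq_empty_or_nonempty with rfl | ⟨y, hy⟩
  · simp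
  refine le_trans ?_ (card_filter_natCast_dvd_le hd)
  refine Finset.card_le_card_of_injOn (fun x => x - y) (fun x hx => ?_)
    (fun _ _ _ _ h => by simpa using h)
  simpa using hs x hx y hy

lemma card_filter_mul_eq_le {q : ℕ} [NeZero q] (x c : ZMod q) :
    (Finset.univ.filter fun y : ZMod q => x * y = c).card ≤ Nat.gcd x.val q := by
  have hq : 0 < q := Nat.pos_of_ne_zero (NeZero.ne q)
  have hg : Nat.gcd x.val q ∣ q := Nat.gcd_dvd_right _ _
  have hg0 : 0 < Nat.gcd x.val q := Nat.gcd_pos_of_pos_right _ hq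
  have h := card_le_of_natCast_dvd_sub (Nat.div_dvd_of_dvd hg)
    (Finset.univ.filter fun y : ZMod q => x * y = c) ?_
  · rwa [Nat.div_div_self hg hq.ne'] at h
  intro y hy y' hy'
  rw [Finset.mem_filter] at hy hy'
  obtain ⟨v, hv⟩ : ∃ v : ℕ, (v : ZMod q) = y - y' := ⟨(y - y').val, by simp⟩
  have h0 : x * (y - y') = 0 := by rw [mul_sub, hy.2, hy'.2, sub_self]
  rw [← hv, ← ZMod.natCast_zmod_val x, ← Nat.cast_mul, ZMod.natCast_eq_zero_iff] at h0
  rw [← hv]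
  apply Nat.cast_dvd_cast
  refine (Nat.coprime_div_gcd_div_gcd hg0).symm.dvd_of_dvd_mul_left
    (m := x.val / Nat.gcd x.val q) ?_
  obtain ⟨k, hk⟩ := h0
  refine ⟨k, Nat.eq_of_mul_eq_mul_left hg0 ?_⟩
  rw [← mul_assoc, ← mul_assoc, Nat.mul_div_cancel' (Nat.gcd_dvd_left _ _),
    Nat.mul_div_cancel' hg, hk]

lemma sum_gcd_val_le (q : ℕ) [NeZero q] :
    ∑ x : ZMod q, Nat.gcd x.val q ≤ q * q.divisors.card := by
  classical
  have hq : q ≠ 0 := NeZero.ne q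
  calc ∑ x : ZMod q, Nat.gcd x.val q
      ≤ ∑ x : ZMod q, ∑ d ∈ q.divisors, if (d : ZMod q) ∣ x then d else 0 := by
        refine Finset.sum_le_sum fun x _ => ?_
        have hmem : Nat.gcd x.val q ∈ q.divisors :=
          Nat.mem_divisors.2 ⟨Nat.gcd_dvd_right _ _, hq⟩
        refine le_trans ?_ (Finset.single_le_sum (fun _ _ => Nat.zero_le _) hmem)
        rw [if_pos]
        conv_rhs => rw [← ZMod.natCast_zmod_val x]
        exact Nat.cast_dvd_cast (Nat.gcd_dvd_left _ _)
    _ = ∑ d ∈ q.divisors, (Finset.univ.filter fun x : ZMod q => (d : ZMod q) ∣ x).card * d := by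
        rw [Finset.sum_comm]
        refine Finset.sum_congr rfl fun d _ => ?_
        rw [← Finset.sum_filter, Finset.sum_const, smul_eq_mul]
    _ ≤ ∑ d ∈ q.divisors, q := by
        refine Finset.sum_le_sum fun d hd => ?_
        have hdq := Nat.dvd_of_mem_divisors hd
        exact (Nat.mul_le_mul_right d (card_filter_natCast_dvd_le hdq)).trans
          (Nat.div_mul_cancel hdq).le
    _ = _ := by simp [mul_comm]

lemma card_filter_prod_mul_eq_le {q : ℕ} [NeZero q] (c : ZMod q) :
    (Finset.univ.filter fun p : ZMod q × ZMod q => p.1 * p.2 = c).card ≤ q * q.divisors.card := by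
  refine le_trans (le_of_eq ?_)
    ((Finset.sum_le_sum fun x _ => card_filter_mul_eq_le x c).trans (sum_gcd_val_le q))
  simp_rw [Finset.card_filter]
  rw [Fintype.sum_prod_type]

end Counting

section Arithmetic

lemma le_totient_mul_card_divisors (n : ℕ) : n ≤ Nat.totient n * n.divisors.card := by
  induction n using Nat.recOnPosPrimePosCoprime with
  | zero => simp
  | one => simp
  | prime_pow p k hp hk =>
    rw [Nat.totient_prime_pow hp hk, Nat.divisors_prime_pow hp, Finset.card_map, Finset.card_range]
    obtain ⟨k, rfl⟩ := Nat.exists_eq_add_of_lt hk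
    obtain ⟨p, rfl⟩ := Nat.exists_eq_add_of_le hp.two_le
    simp only [zero_add, Nat.add_sub_cancel, pow_succ]
    rw [mul_assoc]
    refine Nat.mul_le_mul_left _ ?_
    have : 2 + p - 1 = p + 1 := by omega
    rw [this]
    nlinarith [Nat.zero_le (p * k)]
  | coprime a b ha hb hab iha ihb =>
    rw [Nat.totient_mul hab, hab.card_divisors_mul]
    calc a * b ≤ _ := Nat.mul_le_mul iha ihb
      _ = _ := by ring

/-- The divisor bound `τ(n) ≪ n ^ ε`. -/
lemma exists_card_divisors_le_mul_rpow {ε : ℝ} (hε : 0 < ε) :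
    ∃ C : ℝ, 1 ≤ C ∧ ∀ n : ℕ, 1 ≤ n → (n.divisors.card : ℝ) ≤ C * (n : ℝ) ^ ε := by
  obtain ⟨P, hP⟩ := exists_nat_ge ((2 : ℝ) ^ (1 / ε))
  set δ : ℝ := (2 : ℝ) ^ ε - 1 with hδ
  have hδ0 : 0 < δ := sub_pos.2 (Real.one_lt_rpow one_lt_two hε)
  set M : ℝ := max 1 δ⁻¹ with hM
  have hM1 : 1 ≤ M := le_max_left _ _
  have hMδ : 1 ≤ M * δ := by
    rw [← inv_mul_cancel₀ hδ0.ne']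
    exact mul_le_mul_of_nonneg_right (le_max_right _ _) hδ0.le
  have key : ∀ n : ℕ, 1 ≤ n → (n.divisors.card : ℝ) ≤
      M ^ (n.primeFactors.filter (· < P)).card * (n : ℝ) ^ ε := by
    intro n
    induction n using Nat.recOnPosPrimePosCoprime with
    | zero => simp
    | one => simp
    | prime_pow p k hp hk =>
      intro _
      have hp2 : (2 : ℝ) ≤ p := by exact_mod_cast hp.two_le
      rw [Nat.divisors_prime_pow hp, Finset.card_map, Finset.card_range,
        Nat.primeFactors_prime_pow hk.ne' hp]
      push_cast
      have hpow : ((p : ℝ) ^ k) ^ ε = ((p : ℝ) ^ ε) ^ k := by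
        rw [← Real.rpow_natCast, ← Real.rpow_mul (by positivity), mul_comm,
          Real.rpow_mul (by positivity), Real.rpow_natCast]
      rw [hpow]
      by_cases hpP : p < P
      · rw [Finset.filter_singleton, if_pos hpP, Finset.card_singleton, pow_one]
        have h2 : (2 : ℝ) ^ ε ≤ (p : ℝ) ^ ε := Real.rpow_le_rpow (by norm_num) hp2 hε.le
        have h3 : 1 + (k : ℝ) * δ ≤ (1 + δ) ^ k := one_add_mul_le_pow (by linarith) k
        have h4 : (1 + δ) ^ k ≤ ((p : ℝ) ^ ε) ^ k :=
          pow_le_pow_left₀ (by linarith) (by rw [hδ]; linarith) k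
        calc (k : ℝ) + 1 ≤ M * (1 + k * δ) := by
              nlinarith [mul_le_mul_of_nonneg_left hMδ (Nat.cast_nonneg (α := ℝ) k)]
          _ ≤ M * ((p : ℝ) ^ ε) ^ k := by gcongr; exact h3.trans h4
      · rw [Finset.filter_singleton, if_neg hpP, Finset.card_empty, pow_zero, one_mul]
        have hp' : (2 : ℝ) ^ (1 / ε) ≤ p := hP.trans (by exact_mod_cast not_lt.1 hpP)
        have h2 : (2 : ℝ) ≤ (p : ℝ) ^ ε := by
          calc (2 : ℝ) = ((2 : ℝ) ^ (1 / ε)) ^ ε := by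
                rw [← Real.rpow_mul (by norm_num), one_div_mul_cancel hε.ne', Real.rpow_one]
            _ ≤ _ := Real.rpow_le_rpow (by positivity) hp' hε.le
        calc (k : ℝ) + 1 ≤ 2 ^ k := by exact_mod_cast Nat.lt_two_pow_self (n := k)
          _ ≤ _ := pow_le_pow_left₀ (by norm_num) h2 k
    | coprime a b ha hb hab iha ihb =>
      intro _
      rw [hab.card_divisors_mul, hab.primeFactors_mul, Finset.filter_union,
        Finset.card_union_of_disjoint
          (Finset.disjoint_filter_filter hab.disjoint_primeFactors)]
      push_cast
      rw [Real.mul_rpow (by positivity) (by positivity), pow_add]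
      calc (a.divisors.card : ℝ) * b.divisors.card ≤ _ :=
            mul_le_mul (iha ha.le) (ihb hb.le) (by positivity) (by positivity)
        _ = _ := by ring
  refine ⟨M ^ P, one_le_pow₀ hM1, fun n hn => (key n hn).trans ?_⟩
  gcongr ?_ * _
  refine pow_le_pow_right₀ hM1 ?_
  calc _ ≤ (Finset.range P).card := Finset.card_le_card fun p hp => by
        simpa using (Finset.mem_filter.1 hp).2
    _ = P := Finset.card_range P

end Arithmetic

section CorrelationCount

/-- If the pairs `A, B` and `A', B'` have products `n` and `n'` modulo `q`, then few residues `x`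
satisfy both `A x ≡ A'` modulo `i` and `B ≡ B' x` modulo `j`. -/
lemma mul_mul_card_le_gcd {q i j : ℕ} [NeZero q] (hi : i ∣ q) (hj : j ∣ q) (A B A' B' : ℤ)
    (n n' : ℕ) (hn : (q : ℤ) ∣ A * B - n) (hn' : (q : ℤ) ∣ A' * B' - n') (s : Finset (ZMod q))
    (hs : ∀ x ∈ s, (i : ZMod q) ∣ A * x - A' ∧ (j : ZMod q) ∣ B - B' * x) :
    i * j * s.card ≤ q * (Nat.gcd q (Nat.gcd n n') * Int.gcd q ((n : ℤ) - n')) := by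
  classical
  have hq : 0 < q := Nat.pos_of_ne_zero (NeZero.ne q)
  have hi0 : 0 < i := Nat.pos_of_dvd_of_pos hi hq
  have hj0 : 0 < j := Nat.pos_of_dvd_of_pos hj hq
  rcases s.eq_empty_or_nonempty with rfl | ⟨u, hu⟩
  · simp
  set δ : ℕ := Int.gcd A i with hδ
  set D : ℕ := Int.gcd B' j with hD
  have hδ0 : 0 < δ := Int.gcd_pos_of_ne_zero_right _ (by exact_mod_cast hi0.ne')
  have hD0 : 0 < D := Int.gcd_pos_of_ne_zero_right _ (by exact_mod_cast hj0.ne')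
  have hδA : (δ : ℤ) ∣ A := Int.gcd_dvd_left ..
  have hDB : (D : ℤ) ∣ B' := Int.gcd_dvd_left ..
  have hδi : δ ∣ i := by exact_mod_cast (Int.gcd_dvd_right A i)
  have hDj : D ∣ j := by exact_mod_cast (Int.gcd_dvd_right B' j)
  have hcop : ∀ (X : ℤ) (k m : ℕ), k ∣ q → 0 < k → ∀ v : ℤ, (k : ZMod q) ∣ ((X * v : ℤ) : ZMod q) →
      m = Int.gcd X k → ((k / m : ℕ) : ℤ) ∣ v := by
    intro X k m hk hk0 v hv hm
    rw [natCast_dvd_intCast_zmod_iff hk] at hv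
    have hm0 : 0 < Int.gcd X k := Int.gcd_pos_of_ne_zero_right _ (by exact_mod_cast hk0.ne')
    have hc := Int.isCoprime_iff_gcd_eq_one.2 (Int.gcd_ediv_gcd_ediv_gcd hm0)
    rw [hm]
    push_cast
    refine hc.symm.dvd_of_dvd_mul_left (z := v) ?_
    obtain ⟨r, hr⟩ := hv
    refine ⟨r, mul_left_cancel₀ (a := (Int.gcd X k : ℤ)) (by exact_mod_cast hm0.ne') ?_⟩
    rw [← mul_assoc, ← mul_assoc, Int.mul_ediv_cancel' (Int.gcd_dvd_left ..),
      Int.mul_ediv_cancel' (Int.gcd_dvd_right ..), hr]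
  set L : ℕ := Nat.lcm (i / δ) (j / D) with hL
  have hLq : L ∣ q := Nat.lcm_dvd ((Nat.div_dvd_of_dvd hδi).trans hi)
    ((Nat.div_dvd_of_dvd hDj).trans hj)
  have hcard : s.card ≤ q / L := by
    refine card_le_of_natCast_dvd_sub hLq s fun x hx y hy => ?_
    obtain ⟨v, hv⟩ := ZMod.intCast_surjective (x - y)
    have h1 : ((i / δ : ℕ) : ℤ) ∣ v := by
      refine hcop A i δ hi hi0 v ?_ hδ
      have := dvd_sub (hs x hx).1 (hs y hy).1
      push_cast
      rwa [hv, show (A : ZMod q) * (x - y) = A * x - A' - (A * y - A') by ring]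
    have h2 : ((j / D : ℕ) : ℤ) ∣ v := by
      refine hcop B' j D hj hj0 v ?_ hD
      have := dvd_sub (hs y hy).2 (hs x hx).2
      push_cast
      rwa [hv, show (B' : ZMod q) * (x - y) = B - B' * y - (B - B' * x) by ring]
    rw [← hv, natCast_dvd_intCast_zmod_iff hLq]
    rw [Int.natCast_dvd] at h1 h2 ⊢
    exact Nat.lcm_dvd h1 h2
  obtain ⟨w, rfl⟩ := ZMod.intCast_surjective u
  have hw1 : (i : ℤ) ∣ A * w - A' := by
    rw [← natCast_dvd_intCast_zmod_iff hi]; push_cast; exact (hs _ hu).1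
  have hw2 : (j : ℤ) ∣ B - B' * w := by
    rw [← natCast_dvd_intCast_zmod_iff hj]; push_cast; exact (hs _ hu).2
  set g : ℕ := Nat.gcd (i / δ) (j / D) with hg
  set K : ℕ := δ * D * g with hK
  have hij : i * j = K * L := by
    have := Nat.gcd_mul_lcm (i / δ) (j / D)
    calc i * j = (δ * (i / δ)) * (D * (j / D)) := by
          rw [Nat.mul_div_cancel' hδi, Nat.mul_div_cancel' hDj]
      _ = δ * D * ((i / δ) * (j / D)) := by ring
      _ = K * L := by rw [← this, hK]; ring
  have hKi : K ∣ D * i := by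
    calc K = D * (δ * g) := by rw [hK]; ring
      _ ∣ D * (δ * (i / δ)) := mul_dvd_mul_left _ (mul_dvd_mul_left _ (Nat.gcd_dvd_left _ _))
      _ = D * i := by rw [Nat.mul_div_cancel' hδi]
  have hKj : K ∣ δ * j := by
    calc K = δ * (D * g) := by rw [hK]; ring
      _ ∣ δ * (D * (j / D)) := mul_dvd_mul_left _ (mul_dvd_mul_left _ (Nat.gcd_dvd_right _ _))
      _ = δ * j := by rw [Nat.mul_div_cancel' hDj]
  have hKdiff : (K : ℤ) ∣ A * B - A' * B' := by
    have h1 : (K : ℤ) ∣ A * (B - B' * w) :=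
      (Int.natCast_dvd_natCast.2 hKj).trans (by push_cast; exact mul_dvd_mul hδA hw2)
    have h2 : (K : ℤ) ∣ B' * (A * w - A') :=
      (Int.natCast_dvd_natCast.2 hKi).trans (by push_cast; exact mul_dvd_mul hDB hw1)
    rw [show A * B - A' * B' = A * (B - B' * w) + B' * (A * w - A') by ring]
    exact dvd_add h1 h2
  have hKq : Nat.gcd K q ∣ Int.gcd q ((n : ℤ) - n') := by
    refine Int.dvd_gcd (Int.natCast_dvd_natCast.2 (Nat.gcd_dvd_right _ _)) ?_
    have h1 := (Int.natCast_dvd_natCast.2 (Nat.gcd_dvd_left K q)).trans hKdiff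
    have h2 := (Int.natCast_dvd_natCast.2 (Nat.gcd_dvd_right K q)).trans (dvd_sub hn hn')
    rw [show (n : ℤ) - n' = A * B - A' * B' - (A * B - n - (A' * B' - n')) by ring]
    exact dvd_sub h1 h2
  have hδG : δ ∣ Nat.gcd q (Nat.gcd n n') := by
    have hδq : (δ : ℤ) ∣ q := Int.natCast_dvd_natCast.2 (hδi.trans hi)
    have hδA' : (δ : ℤ) ∣ A' :=
      (dvd_sub_right (hδA.mul_right w)).1 ((Int.natCast_dvd_natCast.2 hδi).trans hw1)
    refine Nat.dvd_gcd (hδi.trans hi) (Nat.dvd_gcd ?_ ?_)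
    · exact Int.natCast_dvd_natCast.1 ((dvd_sub_right (hδA.mul_right B)).1 (hδq.trans hn))
    · exact Int.natCast_dvd_natCast.1 ((dvd_sub_right (hδA'.mul_right B')).1 (hδq.trans hn'))
  have hKle : K ∣ δ * Nat.gcd K q := by
    rw [← Nat.gcd_mul_left]
    exact Nat.dvd_gcd (dvd_mul_left _ _) (hKj.trans (mul_dvd_mul_left _ hj))
  have hGpos : 0 < Nat.gcd q (Nat.gcd n n') * Int.gcd q ((n : ℤ) - n') :=
    Nat.mul_pos (Nat.gcd_pos_of_pos_left _ hq)
      (Int.gcd_pos_of_ne_zero_left _ (by exact_mod_cast hq.ne'))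
  calc i * j * s.card ≤ K * L * (q / L) := by rw [hij]; exact Nat.mul_le_mul_left _ hcard
    _ = q * K := by rw [mul_assoc, Nat.mul_div_cancel' hLq, mul_comm]
    _ ≤ _ := Nat.mul_le_mul_left _
        (Nat.le_of_dvd hGpos (hKle.trans (mul_dvd_mul hδG hKq)))

end CorrelationCount

section ExponentialSums

open ZMod

lemma sum_units_eq_sum_filter {M : Type*} [Monoid M] [Fintype M] [Fintype Mˣ]
    [DecidablePred (IsUnit : M → Prop)] {E : Type*} [AddCommMonoid E] (f : M → E) :
    ∑ u : Mˣ, f u = ∑ x : M with IsUnit x, f x := by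
  refine Finset.sum_nbij (fun u : Mˣ => (u : M)) (by simp) (fun _ _ _ _ h => Units.ext h) ?_
    fun _ _ => rfl
  intro x hx
  obtain ⟨u, rfl⟩ := (Finset.mem_filter.1 (Finset.mem_coe.1 hx)).2
  exact ⟨u, by simp, rfl⟩

open scoped Classical in
lemma sum_moebius_natCast_dvd {q : ℕ} [NeZero q] (x : ZMod q) :
    ∑ d ∈ q.divisors, (if (d : ZMod q) ∣ x then ArithmeticFunction.moebius d else 0) =
      if IsUnit x then 1 else 0 := by
  have hq : q ≠ 0 := NeZero.ne q
  obtain ⟨m, rfl⟩ : ∃ m : ℕ, (m : ZMod q) = x := ⟨x.val, by simp⟩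
  rw [← Finset.sum_filter]
  have h1 : (q.divisors.filter fun d : ℕ => (d : ZMod q) ∣ (m : ZMod q)) =
      (Nat.gcd m q).divisors := by
    ext d
    simp only [Finset.mem_filter, Nat.mem_divisors]
    constructor
    · rintro ⟨⟨hd, -⟩, hdm⟩
      have := (natCast_dvd_intCast_zmod_iff hd (m : ℤ)).1 (by simpa using hdm)
      exact ⟨Nat.dvd_gcd (by exact_mod_cast this) hd, Nat.gcd_ne_zero_right hq⟩
    · rintro ⟨hd, -⟩
      exact ⟨⟨hd.trans (Nat.gcd_dvd_right _ _), hq⟩,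
        Nat.cast_dvd_cast (hd.trans (Nat.gcd_dvd_left _ _))⟩
  rw [h1, ← ArithmeticFunction.coe_mul_zeta_apply, ArithmeticFunction.moebius_mul_coe_zeta,
    ArithmeticFunction.one_apply]
  simp [isUnit_iff_coprime, Nat.Coprime]

open scoped Classical in
lemma norm_sum_filter_natCast_dvd_le {q d : ℕ} [NeZero q] (hd : d ∣ q) (t : ZMod q) :
    ‖∑ x : ZMod q with (d : ZMod q) ∣ x, stdAddChar (t * x)‖ ≤
      if ((q / d : ℕ) : ZMod q) ∣ t then ((q / d : ℕ) : ℝ) else 0 := by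
  split_ifs with h
  · refine (norm_sum_le _ _).trans ?_
    simp only [AddChar.norm_apply, Finset.sum_const, nsmul_eq_mul, mul_one]
    exact_mod_cast card_filter_natCast_dvd_le hd
  · refine le_of_eq (norm_eq_zero.2 ?_)
    have hshift : ∑ x : ZMod q with (d : ZMod q) ∣ x, stdAddChar (t * x) =
        stdAddChar (t * (d : ZMod q)) * ∑ x : ZMod q with (d : ZMod q) ∣ x, stdAddChar (t * x) := by
      rw [Finset.mul_sum]
      symm
      refine Finset.sum_nbij' (fun x => d + x) (fun x => x - d) ?_ ?_ ?_ ?_ ?_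
      · intro x hx; simpa using hx
      · intro x hx; simpa using hx
      · intro x _; simp
      · intro x _; simp
      · intro x _; rw [← AddChar.map_add_eq_mul, mul_add]
    refine eq_zero_of_mul_eq_self_left (fun h1 => h ?_) hshift.symm
    rw [← AddChar.map_zero_eq_one (stdAddChar (N := q))] at h1
    have h2 := injective_stdAddChar h1
    obtain ⟨m, rfl⟩ := intCast_surjective t
    have h3 : (((m * d : ℤ)) : ZMod q) = 0 := by push_cast; exact h2
    rw [intCast_zmod_eq_zero_iff_dvd] at h3
    rw [natCast_dvd_intCast_zmod_iff (Nat.div_dvd_of_dvd hd)]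
    have hd0 : (d : ℤ) ≠ 0 := by
      exact_mod_cast (Nat.pos_of_dvd_of_pos hd (Nat.pos_of_ne_zero (NeZero.ne q))).ne'
    refine Int.dvd_of_mul_dvd_mul_right hd0 ?_
    rwa [← Nat.cast_mul, Nat.div_mul_cancel hd]

open scoped Classical in
lemma norm_ramanujanSum_le {q : ℕ} [NeZero q] (t : ZMod q) :
    ‖ramanujanSum t‖ ≤ ∑ d ∈ q.divisors, if (d : ZMod q) ∣ t then (d : ℝ) else 0 := by
  have h : ramanujanSum t = ∑ d ∈ q.divisors, (ArithmeticFunction.moebius d : ℂ) *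
      ∑ x : ZMod q with (d : ZMod q) ∣ x, stdAddChar (t * x) := by
    unfold ramanujanSum
    rw [sum_units_eq_sum_filter (fun x : ZMod q => (stdAddChar (t * x) : ℂ)), Finset.sum_filter]
    simp_rw [Finset.mul_sum, Finset.sum_filter]
    rw [Finset.sum_comm]
    refine Finset.sum_congr rfl fun x _ => ?_
    have := congrArg (fun k : ℤ => (k : ℂ) * stdAddChar (t * x)) (sum_moebius_natCast_dvd x)
    simp only [Int.cast_sum, Finset.sum_mul] at this
    convert this.symm using 1
    · split_ifs <;> simp
    · refine Finset.sum_congr rfl fun d _ => ?_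
      split_ifs <;> simp
  rw [h, ← Nat.sum_div_divisors q fun d => if (d : ZMod q) ∣ t then (d : ℝ) else 0]
  refine (norm_sum_le _ _).trans (Finset.sum_le_sum fun d hd => ?_)
  rw [norm_mul]
  have hμ : ‖(ArithmeticFunction.moebius d : ℂ)‖ ≤ 1 := by
    rw [Complex.norm_intCast]
    exact_mod_cast ArithmeticFunction.abs_moebius_le_one
  exact (mul_le_of_le_one_left (norm_nonneg _) hμ).trans
    (norm_sum_filter_natCast_dvd_le (Nat.dvd_of_mem_divisors hd) t)

lemma sum_kloostermanSum_mul_conj {q : ℕ} [NeZero q] (A B A' B' : ZMod q) :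
    ∑ h : (ZMod q)ˣ, kloostermanSum A (B * (h : ZMod q)) *
        starRingEnd ℂ (kloostermanSum A' (B' * (h : ZMod q))) =
      ∑ u : (ZMod q)ˣ, ramanujanSum (A * (u : ZMod q) - A') *
        ramanujanSum (B - B' * (u : ZMod q)) := by
  simp only [kloostermanSum, ramanujanSum, map_sum, Finset.sum_mul_sum, ← AddChar.map_neg_eq_conj,
    ← AddChar.map_add_eq_mul]
  rw [Finset.sum_comm]
  calc _ = ∑ x : (ZMod q)ˣ, ∑ y : (ZMod q)ˣ, ∑ h : (ZMod q)ˣ,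
        (stdAddChar (A * (x : ZMod q) + B * (h : ZMod q) * ((x⁻¹ : (ZMod q)ˣ) : ZMod q) +
          -(A' * (y : ZMod q) + B' * (h : ZMod q) * ((y⁻¹ : (ZMod q)ˣ) : ZMod q))) : ℂ) :=
        Finset.sum_congr rfl fun x _ => Finset.sum_comm
    _ = ∑ y : (ZMod q)ˣ, ∑ u : (ZMod q)ˣ, ∑ h : (ZMod q)ˣ,
        (stdAddChar ((A * (u : ZMod q) - A') * (y : ZMod q) +
          (B - B' * (u : ZMod q)) * (h : ZMod q)) : ℂ) := by
        rw [Finset.sum_comm]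
        refine Finset.sum_congr rfl fun y _ => ?_
        refine (Fintype.sum_equiv (Equiv.mulRight y) _ _ fun u => ?_).symm
        refine Fintype.sum_equiv (Equiv.mulRight (u * y)) _ _ fun h => ?_
        congr 1
        simp only [Equiv.coe_mulRight, Units.val_mul, mul_inv]
        have h1 : (y : ZMod q) * ((y⁻¹ : (ZMod q)ˣ) : ZMod q) = 1 := Units.mul_inv y
        have h2 : (u : ZMod q) * ((u⁻¹ : (ZMod q)ˣ) : ZMod q) = 1 := Units.mul_inv u
        linear_combination (-B * h * (u * ((u⁻¹ : (ZMod q)ˣ) : ZMod q)) + B' * h * u) * h1 -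
          B * h * h2
    _ = _ := Finset.sum_comm

lemma norm_sum_kloostermanSum_mul_conj_le {q : ℕ} [NeZero q] (A B A' B' : ZMod q) (n n' : ℕ)
    (hn : A * B = n) (hn' : A' * B' = n') :
    ‖∑ h : (ZMod q)ˣ,
        kloostermanSum A (B * (h : ZMod q)) *
          starRingEnd ℂ (kloostermanSum A' (B' * (h : ZMod q)))‖ ≤
      (q.divisors.card : ℝ) ^ 2 *
        (q * (Nat.gcd q (Nat.gcd n n') * Int.gcd q ((n : ℤ) - n'))) := by
  classical
  rw [sum_kloostermanSum_mul_conj]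
  obtain ⟨A, rfl⟩ := intCast_surjective A
  obtain ⟨B, rfl⟩ := intCast_surjective B
  obtain ⟨A', rfl⟩ := intCast_surjective A'
  obtain ⟨B', rfl⟩ := intCast_surjective B'
  have lift : ∀ (X Y : ℤ) (k : ℕ), (X : ZMod q) * Y = k → (q : ℤ) ∣ X * Y - k := by
    intro X Y k h
    rw [← intCast_zmod_eq_zero_iff_dvd]
    push_cast
    rw [h, sub_self]
  calc _ ≤ ∑ u : (ZMod q)ˣ, ∑ i ∈ q.divisors, ∑ j ∈ q.divisors,
        (if (i : ZMod q) ∣ A * (u : ZMod q) - A' then (i : ℝ) else 0) *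
          (if (j : ZMod q) ∣ B - B' * (u : ZMod q) then (j : ℝ) else 0) := by
        refine (norm_sum_le _ _).trans (Finset.sum_le_sum fun u _ => ?_)
        rw [norm_mul, ← Finset.sum_mul_sum]
        exact mul_le_mul (norm_ramanujanSum_le _) (norm_ramanujanSum_le _) (norm_nonneg _)
          ((norm_nonneg _).trans (norm_ramanujanSum_le _))
    _ = ∑ i ∈ q.divisors, ∑ j ∈ q.divisors, ∑ u : (ZMod q)ˣ,
        (if (i : ZMod q) ∣ A * (u : ZMod q) - A' then (i : ℝ) else 0) *
          (if (j : ZMod q) ∣ B - B' * (u : ZMod q) then (j : ℝ) else 0) := by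
        rw [Finset.sum_comm]
        exact Finset.sum_congr rfl fun i _ => Finset.sum_comm
    _ ≤ ∑ i ∈ q.divisors, ∑ j ∈ q.divisors,
        ((q * (Nat.gcd q (Nat.gcd n n') * Int.gcd q ((n : ℤ) - n')) : ℕ) : ℝ) := by
        refine Finset.sum_le_sum fun i hi => Finset.sum_le_sum fun j hj => ?_
        set s : Finset (ZMod q) := Finset.univ.filter fun x : ZMod q =>
          (i : ZMod q) ∣ A * x - A' ∧ (j : ZMod q) ∣ B - B' * x with hs
        have hcount := mul_mul_card_le_gcd (Nat.dvd_of_mem_divisors hi)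
          (Nat.dvd_of_mem_divisors hj) A B A' B' n n' (lift _ _ _ hn) (lift _ _ _ hn') s
          (fun x hx => (Finset.mem_filter.1 hx).2)
        refine le_trans ?_ (Nat.cast_le.2 hcount)
        rw [sum_units_eq_sum_filter (fun x : ZMod q =>
          (if (i : ZMod q) ∣ A * x - A' then (i : ℝ) else 0) *
            (if (j : ZMod q) ∣ B - B' * x then (j : ℝ) else 0))]
        calc _ ≤ ∑ x : ZMod q, (if (i : ZMod q) ∣ A * x - A' then (i : ℝ) else 0) *
              (if (j : ZMod q) ∣ B - B' * x then (j : ℝ) else 0) := by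
              refine Finset.sum_le_sum_of_subset_of_nonneg (Finset.filter_subset _ _) ?_
              intro x _ _
              positivity
          _ = ∑ x ∈ s, (i : ℝ) * j := by
              rw [hs, Finset.sum_filter]
              refine Finset.sum_congr rfl fun x _ => ?_
              rw [ite_zero_mul_ite_zero]
          _ ≤ _ := by
              rw [Finset.sum_const, nsmul_eq_mul]
              push_cast
              exact (mul_comm _ _).le
    _ = _ := by
        simp only [Finset.sum_const, nsmul_eq_mul]
        push_cast
        ring

end ExponentialSums

section Reduction

open ZMod

lemma sum_Icc_natCast_zmod {q : ℕ} [NeZero q] {E : Type*} [AddCommMonoid E] (F : ZMod q → E) :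
    ∑ x ∈ Finset.Icc 1 q, F (x : ZMod q) = ∑ x : ZMod q, F x := by
  have hq : 0 < q := Nat.pos_of_ne_zero (NeZero.ne q)
  refine Finset.sum_bij' (fun x _ => (x : ZMod q)) (fun x _ => if x = 0 then q else x.val)
    (fun _ _ => Finset.mem_univ _) ?_ ?_ ?_ (fun _ _ => rfl)
  · intro x _
    rw [Finset.mem_Icc]
    split_ifs with h
    · exact ⟨hq, le_rfl⟩
    · exact ⟨Nat.pos_of_ne_zero (by rwa [Ne, val_eq_zero]), (val_lt x).le⟩
  · intro x hx
    obtain ⟨hx1, hx2⟩ := Finset.mem_Icc.1 hx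
    rcases hx2.eq_or_lt with rfl | hlt
    · simp
    · rw [if_neg, val_cast_of_lt hlt]
      rw [natCast_eq_zero_iff]
      exact fun h => absurd (Nat.le_of_dvd hx1 h) (not_le.2 hlt)
  · intro x _
    split_ifs with h <;> simp [h]

lemma sum_Icc_coprime_natCast_zmod {q : ℕ} [NeZero q] (F : ZMod q → ℂ) :
    ∑ h ∈ (Finset.Icc 1 q).filter (fun h => Nat.Coprime h q), F (h : ZMod q) =
      ∑ u : (ZMod q)ˣ, F (u : ZMod q) := by
  classical
  rw [sum_units_eq_sum_filter F, Finset.sum_filter, Finset.sum_filter,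
    ← sum_Icc_natCast_zmod fun x : ZMod q => if IsUnit x then F x else 0]
  simp only [isUnit_iff_coprime]

lemma e_intCast_div {q : ℕ} [NeZero q] (m : ℤ) :
    e ((m : ℝ) / q) = stdAddChar (m : ZMod q) := by
  rw [stdAddChar_coe, e]
  push_cast
  congr 1
  ring

lemma Rabc_eq_sum_zmod {q : ℕ} [NeZero q] (a b c h : ℤ) :
    Rabc a b c h q = ∑ x : ZMod q, ∑ y : ZMod q, ∑ z : ZMod q,
      (stdAddChar (a * x + b * y + c * z - h * x * y * z : ZMod q) : ℂ) := by
  simp only [Rabc, e_intCast_div, ← sum_Icc_natCast_zmod]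
  push_cast
  rfl

/-- Averaging over the torus action `(x, y) ↦ (x u, y u⁻¹)` turns the triple sum into a
combination of Kloosterman sums. -/
lemma card_units_mul_sum_eq {q : ℕ} [NeZero q] (a b c : ZMod q) (h : (ZMod q)ˣ) :
    (Fintype.card (ZMod q)ˣ : ℂ) * ∑ x : ZMod q, ∑ y : ZMod q, ∑ z : ZMod q,
        (stdAddChar (a * x + b * y + c * z - (h : ZMod q) * x * y * z) : ℂ) =
      q * ∑ p : ZMod q × ZMod q with p.1 * p.2 = c,
        kloostermanSum (a * p.1) (b * p.2 * ((h⁻¹ : (ZMod q)ˣ) : ZMod q)) := by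
  have hu : ∀ u : (ZMod q)ˣ, ∑ x : ZMod q, ∑ y : ZMod q, ∑ z : ZMod q,
        (stdAddChar (a * x + b * y + c * z - (h : ZMod q) * x * y * z) : ℂ) =
      ∑ x : ZMod q, ∑ y : ZMod q, if x * y = c then
        (q : ℂ) * stdAddChar (a * x * (u : ZMod q) +
          b * y * ((h⁻¹ : (ZMod q)ˣ) : ZMod q) * ((u⁻¹ : (ZMod q)ˣ) : ZMod q)) else 0 := by
    intro u
    have h1 : (u : ZMod q) * ((u⁻¹ : (ZMod q)ˣ) : ZMod q) = 1 := Units.mul_inv u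
    have h2 : (h : ZMod q) * ((h⁻¹ : (ZMod q)ˣ) : ZMod q) = 1 := Units.mul_inv h
    refine (Fintype.sum_equiv (Units.mulRight u) _ _ fun x => ?_).symm
    refine Fintype.sum_equiv (Units.mulRight (h⁻¹ * u⁻¹)) _ _ fun y => ?_
    calc _ = ∑ z : ZMod q, (stdAddChar (a * x * (u : ZMod q) + b * y *
          ((h⁻¹ : (ZMod q)ˣ) : ZMod q) * ((u⁻¹ : (ZMod q)ˣ) : ZMod q)) : ℂ) *
            stdAddChar (z * (c - x * y)) := by
          rw [← Finset.mul_sum, AddChar.sum_mulShift _ (isPrimitive_stdAddChar q), ZMod.card]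
          by_cases hxy : x * y = c
          · rw [if_pos hxy, if_pos (by rw [hxy, sub_self]), mul_comm]
          · rw [if_neg hxy, if_neg fun h0 => hxy (sub_eq_zero.1 h0).symm]
            simp
      _ = _ := by
          refine Finset.sum_congr rfl fun z _ => ?_
          rw [← AddChar.map_add_eq_mul]
          congr 1
          simp only [Units.mulRight_apply, Units.val_mul]
          linear_combination (x * y * z * ((h : ZMod q) * ((h⁻¹ : (ZMod q)ˣ) : ZMod q))) * h1 +
            x * y * z * h2
  have hsum : ∀ s : ℂ, (Fintype.card (ZMod q)ˣ : ℂ) * s = ∑ _u : (ZMod q)ˣ, s := by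
    intro s; simp
  rw [hsum, Finset.sum_congr rfl fun u _ => hu u, Finset.sum_filter, Fintype.sum_prod_type,
    Finset.sum_comm, Finset.mul_sum]
  refine Finset.sum_congr rfl fun x _ => ?_
  rw [Finset.sum_comm, Finset.mul_sum]
  refine Finset.sum_congr rfl fun y _ => ?_
  by_cases hxy : x * y = c
  · simp only [if_pos hxy, kloostermanSum, Finset.mul_sum]
  · simp [if_neg hxy]

lemma norm_sum_Rabc_mul_conj_le (q : ℕ) [NeZero q] (a b c a' b' c' : ℕ) :
    ‖∑ h ∈ (Finset.Icc 1 q).filter (fun h => Nat.Coprime h q),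
        Rabc a b c h q * starRingEnd ℂ (Rabc a' b' c' h q)‖ ≤
      (q.divisors.card : ℝ) ^ 6 * (q : ℝ) ^ 3 *
        (Nat.gcd q (Nat.gcd (a * b * c) (a' * b' * c')) *
          Int.gcd q (((a * b * c : ℕ) : ℤ) - (a' * b' * c' : ℕ))) := by
  set τ : ℝ := (q.divisors.card : ℝ) with hτ
  set G : ℝ := (Nat.gcd q (Nat.gcd (a * b * c) (a' * b' * c')) : ℝ) *
    Int.gcd q (((a * b * c : ℕ) : ℤ) - (a' * b' * c' : ℕ)) with hG
  have hG0 : 0 ≤ G := by positivity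
  set R : ZMod q → ZMod q → ZMod q → ZMod q → ℂ := fun a b c h =>
    ∑ x : ZMod q, ∑ y : ZMod q, ∑ z : ZMod q,
      (stdAddChar (a * x + b * y + c * z - h * x * y * z) : ℂ) with hR
  set E : ℂ := ∑ u : (ZMod q)ˣ, R a b c (u : ZMod q) * starRingEnd ℂ (R a' b' c' (u : ZMod q))
    with hE
  have hlhs : ∑ h ∈ (Finset.Icc 1 q).filter (fun h => Nat.Coprime h q),
      Rabc a b c h q * starRingEnd ℂ (Rabc a' b' c' h q) = E := by
    rw [hE, ← sum_Icc_coprime_natCast_zmod fun h : ZMod q =>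
      R a b c h * starRingEnd ℂ (R a' b' c' h)]
    simp only [Rabc_eq_sum_zmod, hR, Int.cast_natCast]
  rw [hlhs]
  set P : ZMod q → Finset (ZMod q × ZMod q) := fun c =>
    Finset.univ.filter fun p => p.1 * p.2 = c with hP
  have hPcard : ∀ c, ((P c).card : ℝ) ≤ q * τ := fun c => by
    rw [hτ, hP]
    exact_mod_cast card_filter_prod_mul_eq_le c
  have hexp : (Fintype.card (ZMod q)ˣ : ℂ) ^ 2 * E = (q : ℂ) ^ 2 * ∑ p ∈ P c, ∑ p' ∈ P c',
      ∑ h : (ZMod q)ˣ, kloostermanSum ((a : ZMod q) * p.1) ((b : ZMod q) * p.2 * (h : ZMod q)) *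
        starRingEnd ℂ (kloostermanSum ((a' : ZMod q) * p'.1)
              ((b' : ZMod q) * p'.2 * (h : ZMod q))) := by
    calc _ = ∑ u : (ZMod q)ˣ, ((Fintype.card (ZMod q)ˣ : ℂ) * R a b c (u : ZMod q)) *
          starRingEnd ℂ ((Fintype.card (ZMod q)ˣ : ℂ) * R a' b' c' (u : ZMod q)) := by
          rw [hE, Finset.mul_sum]
          refine Finset.sum_congr rfl fun u _ => ?_
          rw [map_mul, Complex.conj_natCast]
          ring
      _ = ∑ h : (ZMod q)ˣ, ∑ p ∈ P c, ∑ p' ∈ P c', (q : ℂ) ^ 2 *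
          (kloostermanSum ((a : ZMod q) * p.1) ((b : ZMod q) * p.2 * ((h⁻¹ : (ZMod q)ˣ) : ZMod q)) *
            starRingEnd ℂ (kloostermanSum ((a' : ZMod q) * p'.1)
              ((b' : ZMod q) * p'.2 * ((h⁻¹ : (ZMod q)ˣ) : ZMod q)))) := by
          refine Finset.sum_congr rfl fun h _ => ?_
          simp only [hR, card_units_mul_sum_eq]
          rw [map_mul, Complex.conj_natCast, map_sum, mul_mul_mul_comm, Finset.sum_mul_sum,
            Finset.mul_sum]
          refine Finset.sum_congr rfl fun p _ => ?_
          rw [Finset.mul_sum]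
          exact Finset.sum_congr rfl fun p' _ => by ring
      _ = ∑ h : (ZMod q)ˣ, ∑ p ∈ P c, ∑ p' ∈ P c', (q : ℂ) ^ 2 *
          (kloostermanSum ((a : ZMod q) * p.1) ((b : ZMod q) * p.2 * (h : ZMod q)) * starRingEnd ℂ
            (kloostermanSum ((a' : ZMod q) * p'.1)
              ((b' : ZMod q) * p'.2 * (h : ZMod q)))) :=
          Fintype.sum_equiv (Equiv.inv _) _ _ fun h => rfl
      _ = _ := by
          rw [Finset.sum_comm, Finset.mul_sum]
          refine Finset.sum_congr rfl fun p _ => ?_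
          rw [Finset.sum_comm, Finset.mul_sum]
          exact Finset.sum_congr rfl fun p' _ => (Finset.mul_sum _ _ _).symm
  have hbound : (Nat.totient q : ℝ) ^ 2 * ‖E‖ ≤ (q : ℝ) ^ 2 * ((q * τ) * ((q * τ) *
      (τ ^ 2 * (q * G)))) := by
    have hnorm := congrArg norm hexp
    rw [norm_mul, norm_mul, norm_pow, norm_pow, Complex.norm_natCast, Complex.norm_natCast,
      card_units_eq_totient] at hnorm
    rw [hnorm]
    refine mul_le_mul_of_nonneg_left ?_ (by positivity)
    refine (norm_sum_le_of_le _ (n := fun _ => (q * τ) * (τ ^ 2 * (q * G))) fun p hp =>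
      (norm_sum_le_of_le _ (n := fun _ => τ ^ 2 * (q * G)) fun p' hp' => ?_).trans ?_).trans ?_
    · refine norm_sum_kloostermanSum_mul_conj_le _ _ _ _ (a * b * c) (a' * b' * c') ?_ ?_
      · push_cast
        rw [← (Finset.mem_filter.1 hp).2]
        ring
      · push_cast
        rw [← (Finset.mem_filter.1 hp').2]
        ring
    · rw [Finset.sum_const, nsmul_eq_mul]
      exact mul_le_mul_of_nonneg_right (hPcard _) (by positivity)
    · rw [Finset.sum_const, nsmul_eq_mul]
      exact mul_le_mul_of_nonneg_right (hPcard _) (by positivity)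
  have hq : (0 : ℝ) < q := by exact_mod_cast Nat.pos_of_ne_zero (NeZero.ne q)
  have htot : (q : ℝ) ≤ Nat.totient q * τ := by
    rw [hτ]; exact_mod_cast le_totient_mul_card_divisors q
  have hsq : (q : ℝ) ^ 2 ≤ (Nat.totient q : ℝ) ^ 2 * τ ^ 2 := by
    rw [← mul_pow]
    exact pow_le_pow_left₀ hq.le htot 2
  refine le_of_mul_le_mul_left ?_ (pow_pos hq 2)
  calc (q : ℝ) ^ 2 * ‖E‖ ≤ (Nat.totient q : ℝ) ^ 2 * τ ^ 2 * ‖E‖ :=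
        mul_le_mul_of_nonneg_right hsq (norm_nonneg _)
    _ = τ ^ 2 * ((Nat.totient q : ℝ) ^ 2 * ‖E‖) := by ring
    _ ≤ τ ^ 2 * ((q : ℝ) ^ 2 * ((q * τ) * ((q * τ) * (τ ^ 2 * (q * G))))) :=
        mul_le_mul_of_nonneg_left hbound (by positivity)
    _ = _ := by ring

end Reduction

/-- For every `ε > 0` there is `C = C(ε)` such that for every `q ≥ 1` and
positive integers `a, b, c, a′, b′, c′`, with `n = abc` and `n′ = a′b′c′`:
`|Σ′_{h=1}^{q} R_{a,b,c}(h/q) conj(R_{a′,b′,c′}(h/q))|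
  ≤ C q^{3+ε} gcd(q,n,n′) Σ_{f ∣ gcd(q, n−n′)} f`. -/
theorem stmt9 :
    ∀ ε : ℝ, 0 < ε → ∃ C : ℝ, 0 < C ∧
      ∀ q : ℕ, 1 ≤ q → ∀ a b c a' b' c' : ℕ,
        0 < a → 0 < b → 0 < c → 0 < a' → 0 < b' → 0 < c' →
        ‖∑ h ∈ (Finset.Icc 1 q).filter (fun h => Nat.Coprime h q),
            Rabc a b c h q * starRingEnd ℂ (Rabc a' b' c' h q)‖ ≤
          C * (q : ℝ) ^ ((3 : ℝ) + ε) * (Nat.gcd q (Nat.gcd (a * b * c) (a' * b' * c')) : ℝ) *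
            ∑ f ∈ (Int.gcd (q : ℤ)
                ((a * b * c : ℕ) - (a' * b' * c' : ℕ) : ℤ)).divisors, (f : ℝ) := by
  intro ε hε
  obtain ⟨C, hC1, hC⟩ := exists_card_divisors_le_mul_rpow (ε := ε / 6) (by positivity)
  refine ⟨C ^ 6, by positivity, fun q hq a b c a' b' c' _ _ _ _ _ _ => ?_⟩
  have : NeZero q := ⟨by omega⟩
  have hq0 : (0 : ℝ) < q := by exact_mod_cast hq
  refine (norm_sum_Rabc_mul_conj_le q a b c a' b' c').trans ?_
  have hτ : (q.divisors.card : ℝ) ^ 6 ≤ C ^ 6 * (q : ℝ) ^ ε := by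
    refine (pow_le_pow_left₀ (by positivity) (hC q hq) 6).trans (le_of_eq ?_)
    rw [mul_pow, ← Real.rpow_natCast ((q : ℝ) ^ (ε / 6)), ← Real.rpow_mul hq0.le]
    norm_num
  set g := Int.gcd (q : ℤ) ((a * b * c : ℕ) - (a' * b' * c' : ℕ) : ℤ) with hg
  have hg0 : g ≠ 0 := (Int.gcd_pos_of_ne_zero_left _ (by exact_mod_cast this.out)).ne'
  have hσ : (g : ℝ) ≤ ∑ f ∈ g.divisors, (f : ℝ) :=
    Finset.single_le_sum (f := fun f : ℕ => (f : ℝ)) (fun _ _ => Nat.cast_nonneg _)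
      (Nat.mem_divisors_self g hg0)
  have hpow : C ^ 6 * (q : ℝ) ^ ((3 : ℝ) + ε) = C ^ 6 * (q : ℝ) ^ ε * (q : ℝ) ^ 3 := by
    rw [Real.rpow_add hq0, Real.rpow_ofNat]
    ring
  rw [hpow, mul_assoc _ ((Nat.gcd _ _ : ℕ) : ℝ)]
  gcongr
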